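/- Let I, H ⊆ F∖{0} with 2 ≤ |I| ≤ (q−1)/2 and 2 ≤ |H| ≤ (q−1)/2. Then there exists a bijective τ-semilinear map ψ : V → V over F (for some field automorphism τ of F) mapping the set of subspaces A_I onto the set of subspaces A_H if and only if there exist α ∈ F∖{0} and a field automorphism τ′ of F such that one of the following holds: (i) {α·τ′(f) : f ∈ I} = H; (ii) {α·τ′(f)⁻¹ : f ∈ I} = H; (iii) |I| = |H| = (q−1)/2 and {α·τ′(f) : f ∈ I} = (F∖{0})∖H; (iv) |I| = |H| = (q−1)/2 and {α·τ′(f)⁻¹ : f ∈ I} = (F∖{0})∖H. -/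

import Mathlib

/-- J(∞) = {(x,0) : x ∈ K} -/
def Jinf (K : Type) [Field K] : Set (K × K) := {p | p.2 = 0}

/-- J(k) = {(k·x, x) : x ∈ K} -/
def J (K : Type) [Field K] (k : K) : Set (K × K) := {p | p.1 = k * p.2}

/-- J^q(k) = {(k·x^q, x) : x ∈ K} -/
def Jq (K : Type) [Field K] (q : ℕ) (k : K) : Set (K × K) := {p | p.1 = k * p.2 ^ q}

/-- The two-dimensional André spread A_I. -/
def AndreSpread (F K : Type) [Field F] [Field K] [Algebra F K] (q : ℕ) (I : Set F) :
    Set (Set (K × K)) :=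
  {Jinf K, J K 0}
    ∪ {W | ∃ k : K, k ≠ 0 ∧ Algebra.norm F k ∈ I ∧ W = Jq K q k}
    ∪ {W | ∃ k : K, k ≠ 0 ∧ Algebra.norm F k ∉ I ∧ W = J K k}

section FiniteFields

variable {F K : Type} [Field F] [Field K] [Algebra F K] {q : ℕ}

lemma norm_inv_eq [Finite K] (x : K) : Algebra.norm F x⁻¹ = (Algebra.norm F x)⁻¹ := by
  by_cases hx : x = 0
  · simp [hx]
  · apply eq_inv_of_mul_eq_one_left
    rw [← map_mul, inv_mul_cancel₀ hx, map_one]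

lemma ncard_norm_preimage_add_compl [Fintype K] (hcK : Fintype.card K = q ^ 2) (A : Set F) :
    {k : K | Algebra.norm F k ∈ A}.ncard + {k : K | Algebra.norm F k ∉ A}.ncard = q ^ 2 := by
  have h := Set.ncard_add_ncard_compl {k : K | Algebra.norm F k ∈ A}
  rwa [Nat.card_eq_fintype_card, hcK] at h

lemma pow_card_pow_card [Fintype K] (hcK : Fintype.card K = q ^ 2) (x : K) : (x ^ q) ^ q = x := by
  rw [← pow_mul, ← sq, ← hcK, FiniteField.pow_card]

lemma exists_pow_card_ne [Fintype K] (h2 : 2 ≤ q) (hcK : Fintype.card K = q ^ 2) :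
    ∃ x : K, x ^ q ≠ x := by
  classical
  by_contra! h
  have hsub : (Finset.univ : Finset K) ⊆ (Polynomial.X ^ q - Polynomial.X :
      Polynomial K).roots.toFinset := by
    intro x _
    rw [Multiset.mem_toFinset,
      Polynomial.mem_roots (FiniteField.X_pow_card_sub_X_ne_zero K (by omega))]
    simp [h x]
  have h1 := (Finset.card_le_card hsub).trans ((Multiset.toFinset_card_le _).trans
    (Polynomial.card_roots' _))
  rw [FiniteField.X_pow_card_sub_X_natDegree_eq K (by omega), Finset.card_univ, hcK] at h1
  nlinarith

variable [Fintype F]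

lemma two_le_card (hcF : Fintype.card F = q) : 2 ≤ q := by
  have := Fintype.one_lt_card (α := F)
  omega

lemma add_pow_card (hcF : Fintype.card F = q) (x y : K) : (x + y) ^ q = x ^ q + y ^ q := by
  have h := map_add (FiniteField.frobeniusAlgHom F K) x y
  simpa [hcF] using h

lemma algebraMap_pow_card (hcF : Fintype.card F = q) (f : F) :
    (algebraMap F K f) ^ q = algebraMap F K f := by
  rw [← map_pow, ← hcF, FiniteField.pow_card]

lemma norm_pow_card (hcF : Fintype.card F = q) (x : K) :
    Algebra.norm F (x ^ q) = Algebra.norm F x := by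
  rw [map_pow, ← hcF, FiniteField.pow_card]

variable [Fintype K]

lemma algebraMap_norm_eq (hcF : Fintype.card F = q) (hcK : Fintype.card K = q ^ 2) (x : K) :
    algebraMap F K (Algebra.norm F x) = x ^ (q + 1) := by
  rw [FiniteField.algebraMap_norm_eq_pow, Nat.card_eq_fintype_card, Nat.card_eq_fintype_card,
    hcF, hcK]
  congr 1
  have h2 := two_le_card hcF
  apply Nat.div_eq_of_eq_mul_left (by omega)
  have := Nat.sq_sub_sq q 1
  simpa using this

lemma ncard_norm_preimage_le (hcF : Fintype.card F = q) (hcK : Fintype.card K = q ^ 2)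
    (A : Set F) : {k : K | Algebra.norm F k ∈ A}.ncard ≤ (q + 1) * A.ncard := by
  classical
  rw [Set.ncard_eq_toFinset_card' A, Set.ncard_eq_toFinset_card']
  refine Finset.card_le_mul_card_image_of_maps_to (f := fun k : K => Algebra.norm F k)
    (fun k hk => by simpa using hk) _ fun b _ => ?_
  have hsub : Finset.filter (fun k : K => Algebra.norm F k = b)
      (Set.toFinset {k : K | Algebra.norm F k ∈ A}) ⊆
      (Polynomial.nthRoots (q + 1) (algebraMap F K b)).toFinset := by
    intro k hk
    rw [Multiset.mem_toFinset, Polynomial.mem_nthRoots (by omega),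
      ← algebraMap_norm_eq hcF hcK, (Finset.mem_filter.mp hk).2]
  exact (Finset.card_le_card hsub).trans ((Multiset.toFinset_card_le _).trans
    (Polynomial.card_nthRoots _ _))

lemma le_ncard_norm_preimage (hcF : Fintype.card F = q) (hcK : Fintype.card K = q ^ 2)
    {A : Set F} (hA : 2 ≤ A.ncard) : q + 2 ≤ {k : K | Algebra.norm F k ∈ A}.ncard := by
  have h1 := ncard_norm_preimage_le hcF hcK Aᶜ
  have h2 := ncard_norm_preimage_add_compl hcK A
  have h3 := Set.ncard_add_ncard_compl A
  rw [Nat.card_eq_fintype_card, hcF] at h3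
  simp only [Set.mem_compl_iff] at h1
  have h4 : Aᶜ.ncard + 2 ≤ q := by omega
  have := two_le_card hcF
  nlinarith

lemma exists_ringEquiv_extending (τ : F ≃+* F) :
    ∃ s : K ≃+* K, ∀ f, s (algebraMap F K f) = algebraMap F K (τ f) := by
  obtain ⟨p, hp⟩ := CharP.exists F
  have : Fact p.Prime := ⟨CharP.char_is_prime F p⟩
  have hpK : CharP K p := charP_of_injective_algebraMap (algebraMap F K).injective p
  let : Algebra (ZMod p) F := ZMod.algebra F p
  let : Algebra (ZMod p) K := ZMod.algebra K p
  have : IsScalarTower (ZMod p) F K := IsScalarTower.of_algebraMap_eq' (Subsingleton.elim _ _)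
  let χ : F ≃ₐ[ZMod p] F := AlgEquiv.ofRingEquiv (f := τ) fun r =>
    congrArg (fun g : ZMod p →+* F => g r)
      (Subsingleton.elim ((τ : F →+* F).comp (algebraMap (ZMod p) F)) (algebraMap (ZMod p) F))
  exact ⟨(χ.liftNormal K).toRingEquiv, fun f => χ.liftNormal_commutes K f⟩

lemma norm_ringEquiv (hcF : Fintype.card F = q) (hcK : Fintype.card K = q ^ 2) {τ : F ≃+* F}
    {s : K ≃+* K} (hs : ∀ f, s (algebraMap F K f) = algebraMap F K (τ f)) (k : K) :
    Algebra.norm F (s k) = τ (Algebra.norm F k) := by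
  apply (algebraMap F K).injective
  rw [← hs, algebraMap_norm_eq hcF hcK, algebraMap_norm_eq hcF hcK, map_pow]

end FiniteFields

section LinesOverK

variable {F K : Type} [Field F] [Field K] [Algebra F K]

/-- `W` is a one-dimensional `K`-subspace of `K × K`. -/
def IsLine (W : Set (K × K)) : Prop := ∃ w : K × K, w ≠ 0 ∧ W = {v | ∃ k : K, v = k • w}

lemma isLine_J (k : K) : IsLine (J K k) := by
  refine ⟨(k, 1), by simp, ?_⟩
  ext ⟨x, y⟩
  constructor
  · intro h
    exact ⟨y, by simpa [J, mul_comm] using h⟩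
  · rintro ⟨c, hc⟩
    simp only [Prod.smul_mk, smul_eq_mul, Prod.mk.injEq] at hc
    simp [J, hc.1, hc.2, mul_comm]

lemma isLine_Jinf : IsLine (Jinf K) := by
  refine ⟨(1, 0), by simp, ?_⟩
  ext ⟨x, y⟩
  simp [Jinf]

lemma IsLine.exists_smul_eq {φ : K × K → K × K} (hinj : Function.Injective φ) (h0 : φ 0 = 0)
    {W : Set (K × K)} (hW : IsLine (φ '' W)) {w : K × K} (hw : w ≠ 0)
    (hmem : ∀ k : K, k • w ∈ W) (k : K) : ∃ c : K, φ (k • w) = c • φ w := by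
  obtain ⟨w', hw', hW⟩ := hW
  have hline : ∀ k : K, ∃ c : K, φ (k • w) = c • w' := fun k => by
    have : φ (k • w) ∈ φ '' W := ⟨_, hmem k, rfl⟩
    rwa [hW] at this
  obtain ⟨c, hc⟩ := hline k
  obtain ⟨d, hd⟩ := hline 1
  rw [one_smul] at hd
  have hd0 : d ≠ 0 := by
    rintro rfl
    rw [zero_smul, ← h0] at hd
    exact hw (hinj hd)
  refine ⟨c / d, ?_⟩
  rw [hc, hd, smul_smul, div_mul_cancel₀ _ hd0]

variable [Fintype F] [Fintype K] {q : ℕ}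

lemma exists_algebraMap_add_mul (hcF : Fintype.card F = q) (hcK : Fintype.card K = q ^ 2) {m : K}
    (hm : m ∉ Set.range (algebraMap F K)) (y : K) :
    ∃ f g : F, y = algebraMap F K f + algebraMap F K g * m := by
  have hinj : Function.Injective
      fun p : F × F => algebraMap F K p.1 + algebraMap F K p.2 * m := by
    rintro ⟨f, g⟩ ⟨f', g'⟩ h
    simp only at h
    have hg : g = g' := by
      by_contra hne
      apply hm
      have hne' : algebraMap F K (g' - g) ≠ 0 := by
        simpa [sub_eq_zero] using Ne.symm hne
      refine ⟨(f - f') / (g' - g), ?_⟩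
      rw [map_div₀, div_eq_iff hne', map_sub, map_sub]
      linear_combination h
    subst hg
    simpa using h
  have hbij := (Fintype.bijective_iff_injective_and_card _).2
    ⟨hinj, by rw [Fintype.card_prod, hcF, hcK, sq]⟩
  obtain ⟨⟨f, g⟩, h⟩ := hbij.2 y
  exact ⟨f, g, h.symm⟩

lemma semilinear_of_four_lines (hcF : Fintype.card F = q) (hcK : Fintype.card K = q ^ 2)
    {φ : K × K → K × K} (hinj : Function.Injective φ) (hadd : ∀ u v, φ (u + v) = φ u + φ v)
    {τ : F ≃+* F} (hτ : ∀ (f : F) v, φ (f • v) = τ f • φ v) {u v : K × K}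
    (huv : ∀ c : K, u ≠ c • v) (hv : v ≠ 0) {m : K} (hm : m ∉ Set.range (algebraMap F K))
    (hu' : ∀ k : K, ∃ c : K, φ (k • u) = c • φ u)
    (hv' : ∀ k : K, ∃ c : K, φ (k • v) = c • φ v)
    (huv' : ∀ k : K, ∃ c : K, φ (k • (u + v)) = c • φ (u + v))
    (hmuv' : ∀ k : K, ∃ c : K, φ (k • (m • u + v)) = c • φ (m • u + v)) :
    ∃ s : K ≃+* K, ∀ (k : K) w, φ (k • w) = s k • φ w := by
  have h0 : φ 0 = 0 := by simpa using hadd 0 0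
  have hu : u ≠ 0 := by simpa using huv 0
  have hφv : φ v ≠ 0 := fun h => hv (hinj (h.trans h0.symm))
  have hφu : φ u ≠ 0 := fun h => hu (hinj (h.trans h0.symm))
  choose a ha using hu'
  choose b hb using hv'
  choose c hc using huv'
  choose d hd using hmuv'
  have hbinj : Function.Injective b := fun k k' h => by
    have : φ (k • v) = φ (k' • v) := by rw [hb, hb, h]
    exact smul_left_injective K hv (hinj this)
  have hφuv : ∀ c : K, φ u ≠ c • φ v := fun c hc => by
    obtain ⟨k, rfl⟩ := Finite.surjective_of_injective hbinj c
    rw [← hb] at hc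
    exact huv k (hinj hc)
  have hindep : ∀ x y x' y' : K, x • φ u + y • φ v = x' • φ u + y' • φ v → x = x' ∧ y = y' := by
    intro x y x' y' h
    have hx : x = x' := by
      by_contra hne
      have hne' : x - x' ≠ 0 := sub_ne_zero.mpr hne
      apply hφuv ((x - x')⁻¹ * (y' - y))
      have h1 : (x - x') • φ u = (y' - y) • φ v := by
        rw [sub_smul, sub_smul, sub_eq_sub_iff_add_eq_add, h]; abel
      rw [mul_smul, ← h1, inv_smul_smul₀ hne']
    subst hx
    exact ⟨rfl, smul_left_injective K hφv (add_left_cancel h)⟩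
  have hac : ∀ x, a x = c x ∧ b x = c x := fun x => hindep _ _ _ _ <| by
    rw [← ha, ← hb, ← hadd, ← smul_add, hc, hadd, smul_add]
  have hb_eq : ∀ x, b x = a x := fun x => (hac x).2.trans (hac x).1.symm
  have hφ : ∀ x y : K, φ (x • u + y • v) = a x • φ u + a y • φ v := fun x y => by
    rw [hadd, ha, hb, hb_eq]
  have ha_one : a 1 = 1 := by
    have := ha 1
    rw [one_smul] at this
    exact (smul_left_injective K hφu (by simpa using this)).symm
  have ha_add : ∀ x y, a (x + y) = a x + a y := fun x y => by
    apply smul_left_injective K hφu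
    simp only
    rw [← ha, add_smul, hadd, ha, ha, add_smul]
  have ha_zero : a 0 = 0 := by simpa using ha_add 0 0
  have ha_smul : ∀ (f : F) x, a (algebraMap F K f * x) = algebraMap F K (τ f) * a x := fun f x => by
    apply smul_left_injective K hφu
    simp only
    rw [← ha, mul_smul, algebraMap_smul, hτ, ha, mul_smul, algebraMap_smul]
  have ha_alg : ∀ f : F, a (algebraMap F K f) = algebraMap F K (τ f) := fun f => by
    simpa [ha_one] using ha_smul f 1
  have ha_m : ∀ x, a (x * m) = a x * a m := fun x => by
    have h1 := hd x
    rw [smul_add, smul_smul, hφ] at h1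
    have h2 := hφ m 1
    rw [one_smul, ha_one] at h2
    rw [h2, smul_add, smul_smul, smul_smul] at h1
    obtain ⟨h3, h4⟩ := hindep _ _ _ _ h1
    rw [h3, h4, mul_one]
  have ha_mul : ∀ x y, a (x * y) = a x * a y := fun x y => by
    obtain ⟨f, g, rfl⟩ := exists_algebraMap_add_mul hcF hcK hm y
    have h1 : x * (algebraMap F K f + algebraMap F K g * m) =
      algebraMap F K f * x + algebraMap F K g * (x * m) := by ring
    rw [h1, ha_add, ha_add, ha_smul, ha_smul, ha_smul, ha_m, ha_alg]
    ring
  let s : K →+* K :=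
    { toFun := a, map_one' := ha_one, map_mul' := ha_mul, map_zero' := ha_zero, map_add' := ha_add }
  have hs : Function.Bijective s := Finite.injective_iff_bijective.mp s.injective
  have hspan : ∀ w : K × K, ∃ x y : K, w = x • u + y • v := by
    have hinj2 : Function.Injective fun p : K × K => p.1 • u + p.2 • v := by
      rintro ⟨x, y⟩ ⟨x', y'⟩ h
      have h1 := congrArg φ h
      simp only [hφ] at h1
      obtain ⟨h2, h3⟩ := hindep _ _ _ _ h1
      rw [Prod.mk.injEq]
      exact ⟨s.injective h2, s.injective h3⟩
    intro w
    obtain ⟨p, hp⟩ := Finite.surjective_of_injective hinj2 w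
    exact ⟨p.1, p.2, hp.symm⟩
  refine ⟨RingEquiv.ofBijective s hs, fun k w => ?_⟩
  obtain ⟨x, y, rfl⟩ := hspan w
  change _ = a k • _
  rw [smul_add, smul_smul, smul_smul, hφ, hφ, ha_mul, ha_mul, smul_add, smul_smul, smul_smul]

lemma semilinear_of_many_lines (hcF : Fintype.card F = q) (hcK : Fintype.card K = q ^ 2)
    {φ : K × K → K × K} (hinj : Function.Injective φ) (hadd : ∀ u v, φ (u + v) = φ u + φ v)
    {τ : F ≃+* F} (hτ : ∀ (f : F) v, φ (f • v) = τ f • φ v) {T : Set K}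
    (hT : ∀ k ∈ T, IsLine (φ '' J K k)) (hcard : q + 2 ≤ T.ncard) :
    ∃ s : K ≃+* K, ∀ (k : K) w, φ (k • w) = s k • φ w := by
  have h0 : φ 0 = 0 := by simpa using hadd 0 0
  have h2 := two_le_card hcF
  obtain ⟨k₁, k₂, k₃, hk₁, hk₂, hk₃, h12, h13, h23⟩ := (Set.two_lt_ncard_iff T.toFinite).mp
    (show 2 < T.ncard by omega)
  have hline : ∀ k ∈ T, ∀ w : K × K, w ≠ 0 → w.1 = k * w.2 →
      ∀ x : K, ∃ c : K, φ (x • w) = c • φ w := fun k hk w hw hwk x =>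
    (hT k hk).exists_smul_eq hinj h0 hw (fun x => by simp [J, hwk, mul_left_comm]) x
  have h12' := sub_ne_zero.mpr h12
  have h13' := sub_ne_zero.mpr h13
  have h32' := sub_ne_zero.mpr (Ne.symm h23)
  let m : K → K := fun k => ((k₁ - k₃) * (k₂ - k)) / ((k₃ - k₂) * (k - k₁))
  have hmem : ∃ k₄ ∈ T, k₄ ≠ k₁ ∧ m k₄ ∉ Set.range (algebraMap F K) := by
    by_contra! hcon
    have hle : (T \ {k₁}).ncard ≤ (Set.range (algebraMap F K)).ncard := by
      refine Set.ncard_le_ncard_of_injOn m (fun k hk => hcon k hk.1 hk.2) ?_ (Set.toFinite _)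
      intro k hk k' hk' h
      have hk1 := sub_ne_zero.mpr hk.2
      have hk1' := sub_ne_zero.mpr hk'.2
      simp only [m] at h
      rw [div_eq_div_iff (mul_ne_zero h32' hk1) (mul_ne_zero h32' hk1')] at h
      have h3 : (k₁ - k₃) * (k₃ - k₂) * ((k₁ - k₂) * (k - k')) = 0 := by
        linear_combination h
      simpa [h13', h32', h12', sub_eq_zero] using h3
    have hrange : (Set.range (algebraMap F K)).ncard = q := by
      rw [← Set.image_univ, Set.ncard_image_of_injective _ (algebraMap F K).injective,
        Set.ncard_univ, Nat.card_eq_fintype_card, hcF]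
    rw [Set.ncard_sdiff_singleton_of_mem hk₁] at hle
    omega
  obtain ⟨k₄, hk₄, h41, hm⟩ := hmem
  have h41' := sub_ne_zero.mpr h41
  have huv : ∀ c : K, ((k₃ - k₂) * k₁, k₃ - k₂) ≠ c • ((k₁ - k₃) * k₂, k₁ - k₃) := by
    intro c hc
    simp only [Prod.smul_mk, smul_eq_mul, Prod.mk.injEq] at hc
    have : (k₃ - k₂) * (k₁ - k₂) = 0 := by linear_combination hc.1 - k₂ * hc.2
    exact mul_ne_zero h32' h12' this
  have hv : ((k₁ - k₃) * k₂, k₁ - k₃) ≠ (0 : K × K) := fun h => h13' (congrArg Prod.snd h)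
  have hu : ((k₃ - k₂) * k₁, k₃ - k₂) ≠ (0 : K × K) := fun h => h32' (congrArg Prod.snd h)
  have hcomb : ∀ x : K, x • ((k₃ - k₂) * k₁, k₃ - k₂) + ((k₁ - k₃) * k₂, k₁ - k₃)
      ≠ (0 : K × K) := by
    intro x hx
    by_cases hx0 : x = 0
    · subst hx0
      exact hv (by simpa using hx)
    · apply huv (-x⁻¹)
      rw [add_eq_zero_iff_eq_neg] at hx
      rw [neg_smul, ← smul_neg, ← hx, inv_smul_smul₀ hx0]
  refine semilinear_of_four_lines hcF hcK hinj hadd hτ huv hv hm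
    (hline k₁ hk₁ _ hu (mul_comm _ _)) (hline k₂ hk₂ _ hv (mul_comm _ _))
    (hline k₃ hk₃ _ (by simpa only [one_smul] using hcomb 1) ?_) (hline k₄ hk₄ _ (hcomb _) ?_)
  · simp only [Prod.mk_add_mk]
    ring
  · simp only [Prod.smul_mk, Prod.mk_add_mk, smul_eq_mul, m]
    field_simp
    ring

end LinesOverK

section SpreadMaps

variable {F K : Type} [Field F] [Field K] [Algebra F K] {q : ℕ}

lemma mem_andreSpread {I : Set F} {W : Set (K × K)} :
    W ∈ AndreSpread F K q I ↔ W = Jinf K ∨ W = J K 0 ∨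
      (∃ k : K, k ≠ 0 ∧ Algebra.norm F k ∈ I ∧ W = Jq K q k) ∨
      (∃ k : K, k ≠ 0 ∧ Algebra.norm F k ∉ I ∧ W = J K k) := by
  simp only [AndreSpread, Set.mem_union, Set.mem_insert_iff, Set.mem_singleton_iff,
    Set.mem_ofPred_eq, or_assoc]

lemma Jq_injective : Function.Injective (Jq K q) := fun k k' h => by
  have h1 : (k, (1 : K)) ∈ Jq K q k := by simp [Jq]
  rw [h] at h1
  simpa [Jq] using h1

lemma J_mem_andreSpread {I : Set F} {k : K} (hk : Algebra.norm F k ∉ I) :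
    J K k ∈ AndreSpread F K q I := by
  by_cases h : k = 0
  · subst h
    exact mem_andreSpread.2 (Or.inr (Or.inl rfl))
  · exact mem_andreSpread.2 (Or.inr (Or.inr (Or.inr ⟨k, h, hk, rfl⟩)))

lemma Jq_mem_andreSpread {I : Set F} {k : K} (h : k ≠ 0) (hk : Algebra.norm F k ∈ I) :
    Jq K q k ∈ AndreSpread F K q I :=
  mem_andreSpread.2 (Or.inr (Or.inr (Or.inl ⟨k, h, hk, rfl⟩)))

lemma isLine_or_exists_Jq {I : Set F} {W : Set (K × K)} (hW : W ∈ AndreSpread F K q I) :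
    IsLine W ∨ ∃ k : K, k ≠ 0 ∧ Algebra.norm F k ∈ I ∧ W = Jq K q k := by
  rcases mem_andreSpread.1 hW with rfl | rfl | h | ⟨k, -, -, rfl⟩
  · exact Or.inl isLine_Jinf
  · exact Or.inl (isLine_J 0)
  · exact Or.inr h
  · exact Or.inl (isLine_J k)

lemma image_andreSpread {φ : K × K → K × K} {g : F → F} (hg : Function.Injective g)
    (h0 : φ '' Jinf K = Jinf K ∧ φ '' J K 0 = J K 0 ∨ φ '' Jinf K = J K 0 ∧ φ '' J K 0 = Jinf K)
    (hJ : ∀ k : K, k ≠ 0 → ∃ k' : K, k' ≠ 0 ∧ φ '' J K k = J K k' ∧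
      Algebra.norm F k' = g (Algebra.norm F k))
    (hJ' : ∀ k' : K, k' ≠ 0 → ∃ k : K, k ≠ 0 ∧ φ '' J K k = J K k' ∧
      Algebra.norm F k' = g (Algebra.norm F k))
    (hJq : ∀ k : K, k ≠ 0 → ∃ k' : K, k' ≠ 0 ∧ φ '' Jq K q k = Jq K q k' ∧
      Algebra.norm F k' = g (Algebra.norm F k))
    (hJq' : ∀ k' : K, k' ≠ 0 → ∃ k : K, k ≠ 0 ∧ φ '' Jq K q k = Jq K q k' ∧
      Algebra.norm F k' = g (Algebra.norm F k)) (I : Set F) :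
    (fun W => φ '' W) '' AndreSpread F K q I = AndreSpread F K q (g '' I) := by
  ext W
  constructor
  · rintro ⟨W, hW, rfl⟩
    rcases mem_andreSpread.1 hW with rfl | rfl | ⟨k, hk, hkI, rfl⟩ | ⟨k, hk, hkI, rfl⟩
    · rcases h0 with h | h <;> simp [mem_andreSpread, h]
    · rcases h0 with h | h <;> simp [mem_andreSpread, h]
    · obtain ⟨k', hk', h, hN⟩ := hJq k hk
      exact mem_andreSpread.2 (Or.inr (Or.inr (Or.inl ⟨k', hk', hN ▸ ⟨_, hkI, rfl⟩, h⟩)))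
    · obtain ⟨k', hk', h, hN⟩ := hJ k hk
      refine mem_andreSpread.2 (Or.inr (Or.inr (Or.inr ⟨k', hk', ?_, h⟩)))
      rwa [hN, hg.mem_set_image]
  · intro hW
    rcases mem_andreSpread.1 hW with rfl | rfl | ⟨k', hk', hkI, rfl⟩ | ⟨k', hk', hkI, rfl⟩
    · rcases h0 with h | h
      · exact ⟨_, mem_andreSpread.2 (Or.inl rfl), h.1⟩
      · exact ⟨_, mem_andreSpread.2 (Or.inr (Or.inl rfl)), h.2⟩
    · rcases h0 with h | h
      · exact ⟨_, mem_andreSpread.2 (Or.inr (Or.inl rfl)), h.2⟩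
      · exact ⟨_, mem_andreSpread.2 (Or.inl rfl), h.1⟩
    · obtain ⟨k, hk, h, hN⟩ := hJq' k' hk'
      rw [hN, hg.mem_set_image] at hkI
      exact ⟨_, mem_andreSpread.2 (Or.inr (Or.inr (Or.inl ⟨k, hk, hkI, rfl⟩))), h⟩
    · obtain ⟨k, hk, h, hN⟩ := hJ' k' hk'
      rw [hN, hg.mem_set_image] at hkI
      exact ⟨_, mem_andreSpread.2 (Or.inr (Or.inr (Or.inr ⟨k, hk, hkI, rfl⟩))), h⟩

/-- The map `(x, y) ↦ (a s(x), b s(y))`. -/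
def diagMap (a b : K) (s : K ≃+* K) (v : K × K) : K × K := (a * s v.1, b * s v.2)

lemma diagMap_apply_symm_div {a b : K} (ha : a ≠ 0) (hb : b ≠ 0) (s : K ≃+* K) (v : K × K) :
    diagMap a b s (s.symm (v.1 / a), s.symm (v.2 / b)) = v := by
  simp [diagMap, mul_div_cancel₀, ha, hb]

lemma diagMap_bijective {a b : K} (ha : a ≠ 0) (hb : b ≠ 0) (s : K ≃+* K) :
    Function.Bijective (diagMap a b s) := by
  refine ⟨fun u v h => ?_, fun v => ⟨_, diagMap_apply_symm_div ha hb s v⟩⟩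
  simp only [diagMap, Prod.mk.injEq, mul_right_inj' ha, mul_right_inj' hb,
    EmbeddingLike.apply_eq_iff_eq] at h
  exact Prod.ext h.1 h.2

lemma image_diagMap_eq {a b : K} (ha : a ≠ 0) (hb : b ≠ 0) (s : K ≃+* K) {W W' : Set (K × K)}
    (h : ∀ v, v ∈ W ↔ diagMap a b s v ∈ W') : diagMap a b s '' W = W' := by
  ext v
  constructor
  · rintro ⟨u, hu, rfl⟩
    exact (h u).1 hu
  · intro hv
    refine ⟨_, (h _).2 ?_, diagMap_apply_symm_div ha hb s v⟩
    rwa [diagMap_apply_symm_div ha hb]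

lemma image_diagMap_Jinf {a b : K} (ha : a ≠ 0) (hb : b ≠ 0) (s : K ≃+* K) :
    diagMap a b s '' Jinf K = Jinf K :=
  image_diagMap_eq ha hb s fun v => by simp [diagMap, Jinf, hb]

lemma image_diagMap_J {a b : K} (ha : a ≠ 0) (hb : b ≠ 0) (s : K ≃+* K) (k : K) :
    diagMap a b s '' J K k = J K (a / b * s k) :=
  image_diagMap_eq ha hb s fun v => by
    have h : a / b * s k * (b * s v.2) = a * s (k * v.2) := by
      rw [map_mul]; field_simp
    simp [diagMap, J, h, ha, -map_mul]

lemma image_diagMap_Jq {a b : K} (ha : a ≠ 0) (hb : b ≠ 0) (s : K ≃+* K) (k : K) :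
    diagMap a b s '' Jq K q k = Jq K q (a / b ^ q * s k) :=
  image_diagMap_eq ha hb s fun v => by
    have h : a / b ^ q * s k * (b * s v.2) ^ q = a * s (k * v.2 ^ q) := by
      rw [map_mul, map_pow, mul_pow]; field_simp
    simp [diagMap, Jq, h, ha, -map_mul, -map_pow]

lemma image_swap_Jinf : Prod.swap '' Jinf K = J K 0 := by
  ext ⟨x, y⟩
  simp [Set.image_swap_eq_preimage_swap, Jinf, J]

lemma image_swap_J_zero : Prod.swap '' J K 0 = Jinf K := by
  ext ⟨x, y⟩
  simp [Set.image_swap_eq_preimage_swap, Jinf, J]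

lemma image_swap_J {k : K} (hk : k ≠ 0) : Prod.swap '' J K k = J K k⁻¹ := by
  ext ⟨x, y⟩
  simp only [Set.image_swap_eq_preimage_swap, Set.mem_preimage, Prod.swap_prod_mk, J,
    Set.mem_ofPred_eq]
  rw [eq_inv_mul_iff_mul_eq₀ hk, eq_comm]

/-- The map `(x, y) ↦ (x ^ q, y)`. -/
def conjFst (q : ℕ) (v : K × K) : K × K := (v.1 ^ q, v.2)

lemma conjFst_add [Fintype F] (hcF : Fintype.card F = q) (u v : K × K) :
    conjFst q (u + v) = conjFst q u + conjFst q v := by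
  simp [conjFst, add_pow_card hcF]

lemma conjFst_smul [Fintype F] (hcF : Fintype.card F = q) (f : F) (v : K × K) :
    conjFst q (f • v) = f • conjFst q v := by
  simp [conjFst, Algebra.smul_def, mul_pow, algebraMap_pow_card hcF]

variable [Fintype K]

lemma image_swap_Jq (hcK : Fintype.card K = q ^ 2) {k : K} (hk : k ≠ 0) :
    Prod.swap '' Jq K q k = Jq K q ((k ^ q)⁻¹) := by
  ext ⟨x, y⟩
  simp only [Set.image_swap_eq_preimage_swap, Set.mem_preimage, Prod.swap_prod_mk, Jq,
    Set.mem_ofPred_eq]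
  rw [eq_inv_mul_iff_mul_eq₀ (pow_ne_zero _ hk)]
  constructor
  · rintro rfl
    rw [mul_pow, pow_card_pow_card hcK]
  · intro h
    rw [← pow_card_pow_card hcK y, ← h, mul_pow, pow_card_pow_card hcK]

lemma not_isLine_Jq (h2 : 2 ≤ q) (hcK : Fintype.card K = q ^ 2) {k : K} (hk : k ≠ 0) :
    ¬ IsLine (Jq K q k) := by
  rintro ⟨w, hw, h⟩
  obtain ⟨x, hx⟩ := exists_pow_card_ne h2 hcK
  have h1 : (k, (1 : K)) ∈ Jq K q k := by simp [Jq]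
  rw [h] at h1
  obtain ⟨c, hc⟩ := h1
  have h3 : (x * k, x) ∈ Jq K q k := by
    rw [h]
    refine ⟨x * c, ?_⟩
    rw [mul_smul, ← hc]
    simp
  apply hx
  apply mul_left_cancel₀ hk
  rw [mul_comm k x]
  exact (show x * k = k * x ^ q from h3).symm

lemma conjFst_involutive (hcK : Fintype.card K = q ^ 2) :
    Function.Involutive (conjFst (K := K) q) := fun v => by
  simp [conjFst, pow_card_pow_card hcK]

lemma mem_image_conjFst (hcK : Fintype.card K = q ^ 2) {W : Set (K × K)} {v : K × K} :
    v ∈ conjFst q '' W ↔ conjFst q v ∈ W := by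
  rw [Set.image_eq_preimage_of_inverse (conjFst_involutive hcK).leftInverse
    (conjFst_involutive hcK).rightInverse, Set.mem_preimage]

lemma image_conjFst_Jinf (hcK : Fintype.card K = q ^ 2) : conjFst q '' Jinf K = Jinf K := by
  ext v
  simp [mem_image_conjFst hcK, Jinf, conjFst]

lemma image_conjFst_J (hcK : Fintype.card K = q ^ 2) (k : K) :
    conjFst q '' J K k = Jq K q (k ^ q) := by
  ext v
  simp only [mem_image_conjFst hcK, J, Jq, conjFst, Set.mem_ofPred_eq]
  constructor
  · intro h
    rw [← pow_card_pow_card hcK v.1, h, mul_pow]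
  · intro h
    rw [h, mul_pow, pow_card_pow_card hcK, pow_card_pow_card hcK]

lemma image_conjFst_Jq (hcK : Fintype.card K = q ^ 2) (k : K) :
    conjFst q '' Jq K q k = J K (k ^ q) := by
  rw [← pow_card_pow_card hcK k, ← image_conjFst_J hcK, ← Set.image_comp,
    (conjFst_involutive hcK).comp_self, Set.image_id, pow_card_pow_card hcK]

variable [Fintype F]

lemma image_andreSpread_conjFst (hcF : Fintype.card F = q) (hcK : Fintype.card K = q ^ 2)
    (I : Set F) : (fun W => conjFst q '' W) '' AndreSpread F K q I =
      AndreSpread F K q ({f : F | f ≠ 0} \ I) := by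
  have hsub : ∀ I : Set F, ∀ W ∈ AndreSpread F K q I,
      conjFst q '' W ∈ AndreSpread F K q ({f : F | f ≠ 0} \ I) := by
    intro I W hW
    have h2 := two_le_card hcF
    rcases mem_andreSpread.1 hW with rfl | rfl | ⟨k, hk, hkI, rfl⟩ | ⟨k, hk, hkI, rfl⟩
    · exact mem_andreSpread.2 (Or.inl (image_conjFst_Jinf hcK))
    · refine mem_andreSpread.2 (Or.inr (Or.inl ?_))
      rw [image_conjFst_J hcK, zero_pow (by omega)]
      simp [J, Jq]
    · rw [image_conjFst_Jq hcK]
      exact J_mem_andreSpread (by rw [norm_pow_card hcF]; exact fun h => h.2 hkI)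
    · rw [image_conjFst_J hcK]
      exact Jq_mem_andreSpread (pow_ne_zero _ hk)
        (by rw [norm_pow_card hcF]; exact ⟨Algebra.norm_ne_zero_iff.mpr hk, hkI⟩)
  have hdiff : AndreSpread F K q ({f : F | f ≠ 0} \ ({f : F | f ≠ 0} \ I)) =
      AndreSpread F K q I := by
    ext W
    simp only [mem_andreSpread]
    have : ∀ k : K, k ≠ 0 → (Algebra.norm F k ∈ ({f : F | f ≠ 0} \ ({f : F | f ≠ 0} \ I)) ↔
        Algebra.norm F k ∈ I) := fun k hk => by
      have := (Algebra.norm_ne_zero_iff (R := F)).mpr hk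
      simp [this]
    grind
  apply Set.Subset.antisymm
  · rintro _ ⟨W, hW, rfl⟩
    exact hsub I W hW
  · intro W hW
    refine ⟨conjFst q '' W, hdiff ▸ hsub _ W hW, ?_⟩
    simp only
    rw [← Set.image_comp, (conjFst_involutive hcK).comp_self, Set.image_id]

lemma image_andreSpread_swap (hcF : Fintype.card F = q) (hcK : Fintype.card K = q ^ 2)
    (I : Set F) : (fun W => Prod.swap '' W) '' AndreSpread F K q I =
      AndreSpread F K q ((fun f => f⁻¹) '' I) := by
  have hN : ∀ k : K, Algebra.norm F k⁻¹ = (Algebra.norm F k)⁻¹ := norm_inv_eq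
  refine image_andreSpread inv_injective (Or.inr ⟨image_swap_Jinf, image_swap_J_zero⟩)
    (fun k hk => ⟨k⁻¹, inv_ne_zero hk, image_swap_J hk, hN k⟩)
    (fun k hk => ⟨k⁻¹, inv_ne_zero hk, ?_, ?_⟩)
    (fun k hk => ⟨_, inv_ne_zero (pow_ne_zero q hk), image_swap_Jq hcK hk, ?_⟩)
    (fun k hk => ⟨_, inv_ne_zero (pow_ne_zero q hk), ?_, ?_⟩) I
  · rw [image_swap_J (inv_ne_zero hk), inv_inv]
  · rw [hN, inv_inv]
  · rw [hN, norm_pow_card hcF]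
  · rw [image_swap_Jq hcK (inv_ne_zero (pow_ne_zero q hk)), inv_pow, inv_inv,
      pow_card_pow_card hcK]
  · rw [hN, norm_pow_card hcF, inv_inv]

lemma image_andreSpread_diagMap (hcF : Fintype.card F = q) (hcK : Fintype.card K = q ^ 2)
    {τ : F ≃+* F} {s : K ≃+* K} (hs : ∀ f, s (algebraMap F K f) = algebraMap F K (τ f)) {a b : K}
    (ha : a ≠ 0) (hb : b ≠ 0) (I : Set F) :
    (fun W => diagMap a b s '' W) '' AndreSpread F K q I =
      AndreSpread F K q ((fun f => Algebra.norm F (a / b) * τ f) '' I) := by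
  have hab : a / b ≠ 0 := div_ne_zero ha hb
  have habq : a / b ^ q ≠ 0 := div_ne_zero ha (pow_ne_zero _ hb)
  have hab0 : Algebra.norm F (a / b) ≠ 0 := Algebra.norm_ne_zero_iff.mpr hab
  have hNq : Algebra.norm F (a / b ^ q) = Algebra.norm F (a / b) := by
    rw [div_eq_mul_inv, div_eq_mul_inv, map_mul, map_mul, norm_inv_eq, norm_inv_eq,
      norm_pow_card hcF]
  have hN : ∀ k, Algebra.norm F (a / b * s k) = Algebra.norm F (a / b) * τ (Algebra.norm F k) :=
    fun k => by rw [map_mul, norm_ringEquiv hcF hcK hs]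
  have hN' : ∀ k, Algebra.norm F (a / b ^ q * s k) =
      Algebra.norm F (a / b) * τ (Algebra.norm F k) :=
    fun k => by rw [map_mul, norm_ringEquiv hcF hcK hs, hNq]
  have hs0 : ∀ k, k ≠ 0 → s k ≠ 0 := fun k hk => by simpa using hk
  have hinv : ∀ c k : K, c ≠ 0 → c * s (s.symm (k / c)) = k := fun c k hc => by
    rw [RingEquiv.apply_symm_apply, mul_div_cancel₀ _ hc]
  have hinv0 : ∀ c k : K, c ≠ 0 → k ≠ 0 → s.symm (k / c) ≠ 0 := fun c k hc hk => by
    simp [hc, hk]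
  refine image_andreSpread (fun f f' h => τ.injective (mul_left_cancel₀ hab0 h))
    (Or.inl ⟨image_diagMap_Jinf ha hb s, by rw [image_diagMap_J ha hb, map_zero, mul_zero]⟩)
    (fun k hk => ⟨_, mul_ne_zero hab (hs0 k hk), image_diagMap_J ha hb s k, hN k⟩)
    (fun k hk => ⟨_, hinv0 _ k hab hk, ?_, ?_⟩)
    (fun k hk => ⟨_, mul_ne_zero habq (hs0 k hk), image_diagMap_Jq ha hb s k, hN' k⟩)
    (fun k hk => ⟨_, hinv0 _ k habq hk, ?_, ?_⟩) I
  · rw [image_diagMap_J ha hb, hinv _ _ hab]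
  · rw [← hN, hinv _ _ hab]
  · rw [image_diagMap_Jq ha hb, hinv _ _ habq]
  · rw [← hN', hinv _ _ habq]

lemma subset_of_andreSpread_eq (hcF : Fintype.card F = q) (hcK : Fintype.card K = q ^ 2)
    {I H : Set F} (hI : I ⊆ {f : F | f ≠ 0})
    (h : AndreSpread F K q I = AndreSpread F K q H) : I ⊆ H := by
  intro f hf
  obtain ⟨k, rfl⟩ := FiniteField.norm_surjective F K f
  have hk : k ≠ 0 := Algebra.norm_ne_zero_iff.mp (hI hf)
  have hmem := Jq_mem_andreSpread (q := q) hk hf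
  rw [h] at hmem
  rcases isLine_or_exists_Jq hmem with hl | ⟨k', hk', hk'H, hkk'⟩
  · exact absurd hl (not_isLine_Jq (two_le_card hcF) hcK hk)
  · rwa [Jq_injective hkk']

lemma eq_of_andreSpread_eq (hcF : Fintype.card F = q) (hcK : Fintype.card K = q ^ 2)
    {I H : Set F} (hI : I ⊆ {f : F | f ≠ 0}) (hH : H ⊆ {f : F | f ≠ 0})
    (h : AndreSpread F K q I = AndreSpread F K q H) : I = H :=
  (subset_of_andreSpread_eq hcF hcK hI h).antisymm (subset_of_andreSpread_eq hcF hcK hH h.symm)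

end SpreadMaps

section SpreadIsomorphisms

variable {F K : Type} [Field F] [Field K] [Algebra F K] {q : ℕ}

lemma isLine_of_isLine_image {ψ : K × K → K × K} (hbij : Function.Bijective ψ) {s : K ≃+* K}
    (hs : ∀ (k : K) v, ψ (k • v) = s k • ψ v) {W : Set (K × K)} (hW : IsLine (ψ '' W)) :
    IsLine W := by
  obtain ⟨w', hw', h⟩ := hW
  obtain ⟨w, rfl⟩ := hbij.2 w'
  have h0 : ψ 0 = 0 := by simpa using hs 0 0
  refine ⟨w, fun hw => hw' (hw ▸ h0), ?_⟩
  ext v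
  rw [← hbij.1.mem_set_image, h]
  constructor
  · rintro ⟨k, hk⟩
    refine ⟨s.symm k, hbij.1 ?_⟩
    rw [hs, RingEquiv.apply_symm_apply, hk]
  · rintro ⟨k, rfl⟩
    exact ⟨s k, hs k w⟩

/-- The spreads `A_I` and `A_H` are equivalent under a bijective semilinear map. -/
def SpreadEquiv (F K : Type) [Field F] [Field K] [Algebra F K] (q : ℕ) (I H : Set F) : Prop :=
  ∃ (τ : F ≃+* F) (ψ : K × K → K × K),
    Function.Bijective ψ ∧
    (∀ u v : K × K, ψ (u + v) = ψ u + ψ v) ∧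
    (∀ (f : F) (v : K × K), ψ (f • v) = τ f • ψ v) ∧
    (fun W => ψ '' W) '' AndreSpread F K q I = AndreSpread F K q H

lemma SpreadEquiv.trans {I H L : Set F} (h₁ : SpreadEquiv F K q I H)
    (h₂ : SpreadEquiv F K q H L) : SpreadEquiv F K q I L := by
  obtain ⟨τ, ψ, hbij, hadd, hτ, himg⟩ := h₁
  obtain ⟨τ', ψ', hbij', hadd', hτ', himg'⟩ := h₂
  refine ⟨τ.trans τ', ψ' ∘ ψ, hbij'.comp hbij, by simp [hadd, hadd'], by simp [hτ, hτ'], ?_⟩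
  rw [← himg', ← himg, Set.image_image]
  simp only [Set.image_comp]

lemma ncard_eq_half [Fintype F] (hcF : Fintype.card F = q) {I H : Set F} (hH : H ⊆ {f : F | f ≠ 0})
    (hIhalf : 2 * I.ncard ≤ q - 1) (hHhalf : 2 * H.ncard ≤ q - 1) {g : F → F}
    (hg : Function.Injective g) (h : g '' I = {f : F | f ≠ 0} \ H) :
    2 * I.ncard = q - 1 ∧ 2 * H.ncard = q - 1 := by
  have h1 := congrArg Set.ncard h
  have h2 := Set.ncard_add_ncard_compl ({0} : Set F)
  rw [Set.ncard_singleton, Nat.card_eq_fintype_card, hcF] at h2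
  have h3 : ({f : F | f ≠ 0} : Set F).ncard = ({0} : Set F)ᶜ.ncard := rfl
  rw [Set.ncard_image_of_injective _ hg, Set.ncard_sdiff hH (Set.toFinite _)] at h1
  omega

variable [Fintype F] [Fintype K]

lemma image_andreSpread_of_semilinear (hcF : Fintype.card F = q) (hcK : Fintype.card K = q ^ 2)
    {I H : Set F} (hI : I ⊆ {f : F | f ≠ 0}) (hI2 : 2 ≤ I.ncard) {τ : F ≃+* F} {ψ : K × K → K × K}
    (hbij : Function.Bijective ψ) (hadd : ∀ u v, ψ (u + v) = ψ u + ψ v)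
    (hτ : ∀ (f : F) v, ψ (f • v) = τ f • ψ v) {s : K ≃+* K}
    (hs : ∀ (k : K) v, ψ (k • v) = s k • ψ v)
    (himg : (fun W => ψ '' W) '' AndreSpread F K q I = AndreSpread F K q H) :
    ∃ a b : K, a ≠ 0 ∧ b ≠ 0 ∧ (ψ = diagMap a b s ∨ ψ = Prod.swap ∘ diagMap a b s) := by
  have h2 := two_le_card hcF
  obtain ⟨s', hs'⟩ : ∃ s' : K ≃+* K, ∀ (k : K) v,
      conjFst q (ψ (conjFst q (k • v))) = s' k • conjFst q (ψ (conjFst q v)) := by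
    refine semilinear_of_many_lines hcF hcK (φ := fun v => conjFst q (ψ (conjFst q v)))
      (τ := τ) (T := {k : K | Algebra.norm F k ∈ I})
      ((conjFst_involutive hcK).injective.comp
        (hbij.1.comp (conjFst_involutive hcK).injective))
      (fun u v => by simp only [conjFst_add hcF, hadd])
      (fun f v => by simp only [conjFst_smul hcF, hτ]) ?_ (le_ncard_norm_preimage hcF hcK hI2)
    intro k hk
    have hk0 : k ^ q ≠ 0 := pow_ne_zero _ (Algebra.norm_ne_zero_iff.mp (hI hk))
    have hmem : ψ '' Jq K q (k ^ q) ∈ AndreSpread F K q H := himg ▸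
      Set.mem_image_of_mem _ (Jq_mem_andreSpread hk0 (by rwa [norm_pow_card hcF]))
    rcases isLine_or_exists_Jq hmem with hl | ⟨k', -, -, hk'⟩
    · exact absurd (isLine_of_isLine_image hbij hs hl) (not_isLine_Jq h2 hcK hk0)
    · have : (fun v => conjFst q (ψ (conjFst q v))) '' J K k = J K (k' ^ q) := by
        rw [← image_conjFst_Jq hcK, ← hk', ← image_conjFst_J hcK, ← Set.image_comp,
          ← Set.image_comp]
        rfl
      rw [this]
      exact isLine_J _
  have aux : ∀ x y : K, (∀ k, s' k * x = s k * x) → (∀ k, s' k * y = s k ^ q * y) →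
      x = 0 ∨ y = 0 := by
    intro x y hx hy
    by_contra! h
    obtain ⟨z, hz⟩ := exists_pow_card_ne h2 hcK
    have h1 := mul_right_cancel₀ h.1 (hx (s.symm z))
    have h3 := mul_right_cancel₀ h.2 (hy (s.symm z))
    rw [h1, RingEquiv.apply_symm_apply] at h3
    exact hz h3.symm
  have hq0 : q ≠ 0 := by omega
  obtain ⟨p, r, hpr⟩ : ∃ p r : K, ψ (1, 0) = (p, r) := ⟨_, _, rfl⟩
  obtain ⟨p', r', hpr'⟩ : ∃ p' r' : K, ψ (0, 1) = (p', r') := ⟨_, _, rfl⟩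
  have hψ : ∀ x y : K, ψ (x, y) = (s x * p + s y * p', s x * r + s y * r') := fun x y => by
    have : ((x, y) : K × K) = x • (1, 0) + y • (0, 1) := by simp
    rw [this, hadd, hs, hs, hpr, hpr']
    simp
  have h10 : p ^ q = 0 ∨ r = 0 := by
    have key : ∀ k, s' k * p ^ q = s k * p ^ q ∧ s' k * r = s k ^ q * r := fun k => by
      have := hs' k (1, 0)
      simpa [conjFst, hψ, hq0, mul_pow, pow_card_pow_card hcK, eq_comm] using this
    exact aux _ _ (fun k => (key k).1) fun k => (key k).2
  have h01 : r' = 0 ∨ p' ^ q = 0 := by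
    have key : ∀ k, s' k * p' ^ q = s k ^ q * p' ^ q ∧ s' k * r' = s k * r' := fun k => by
      have := hs' k (0, 1)
      simpa [conjFst, hψ, hq0, mul_pow, pow_card_pow_card hcK, eq_comm] using this
    exact aux _ _ (fun k => (key k).2) fun k => (key k).1
  rw [pow_eq_zero_iff hq0] at h10 h01
  have hsurj : ∀ u v : K, ∃ x y : K, s x * p + s y * p' = u ∧ s x * r + s y * r' = v :=
    fun u v => by
      obtain ⟨⟨x, y⟩, h⟩ := hbij.2 (u, v)
      rw [hψ, Prod.mk.injEq] at h
      exact ⟨x, y, h⟩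
  obtain ⟨x₁, y₁, h11, h12⟩ := hsurj 1 0
  obtain ⟨x₂, y₂, h21, h22⟩ := hsurj 0 1
  rcases h10 with hp | hr <;> rcases h01 with hr' | hp'
  · refine ⟨r, p', ?_, ?_, Or.inr ?_⟩
    · rintro rfl
      simp [hr'] at h22
    · rintro rfl
      simp [hp] at h11
    · ext ⟨x, y⟩ <;> simp [hψ, diagMap, hp, hr', mul_comm]
  · simp [hp, hp'] at h11
  · simp [hr, hr'] at h22
  · refine ⟨p, r', ?_, ?_, Or.inl ?_⟩
    · rintro rfl
      simp [hp'] at h11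
    · rintro rfl
      simp [hr] at h22
    · ext ⟨x, y⟩ <;> simp [hψ, diagMap, hr, hp', mul_comm]

lemma exists_image_eq_of_semilinear (hcF : Fintype.card F = q) (hcK : Fintype.card K = q ^ 2)
    {I H : Set F} (hI : I ⊆ {f : F | f ≠ 0}) (hH : H ⊆ {f : F | f ≠ 0}) (hI2 : 2 ≤ I.ncard)
    {τ : F ≃+* F} {ψ : K × K → K × K}
    (hbij : Function.Bijective ψ) (hadd : ∀ u v, ψ (u + v) = ψ u + ψ v)
    (hτ : ∀ (f : F) v, ψ (f • v) = τ f • ψ v) {s : K ≃+* K}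
    (hs : ∀ (k : K) v, ψ (k • v) = s k • ψ v)
    (himg : (fun W => ψ '' W) '' AndreSpread F K q I = AndreSpread F K q H) :
    ∃ α : F, α ≠ 0 ∧ ((fun f => α * τ f) '' I = H ∨ (fun f => α * (τ f)⁻¹) '' I = H) := by
  obtain ⟨a, b, ha, hb, hψ⟩ := image_andreSpread_of_semilinear hcF hcK hI hI2 hbij hadd hτ hs himg
  have hsτ : ∀ f, s (algebraMap F K f) = algebraMap F K (τ f) := fun f => by
    obtain ⟨v, hv⟩ := hbij.2 (1, 0)
    have h1 := hτ f v
    rw [← algebraMap_smul K f v, ← algebraMap_smul K (τ f), hs, hv] at h1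
    simpa [Algebra.smul_def] using h1
  have hab0 : Algebra.norm F (a / b) ≠ 0 := Algebra.norm_ne_zero_iff.mpr (div_ne_zero ha hb)
  have hdiag := image_andreSpread_diagMap hcF hcK hsτ ha hb I
  have hsub : (fun f => Algebra.norm F (a / b) * τ f) '' I ⊆ {f : F | f ≠ 0} := by
    rintro _ ⟨f, hf, rfl⟩
    have := hI hf
    simp_all
  rcases hψ with rfl | rfl
  · refine ⟨_, hab0, Or.inl (eq_of_andreSpread_eq hcF hcK hsub hH ?_)⟩
    rw [← hdiag, himg]
  · refine ⟨_, inv_ne_zero hab0, Or.inr ?_⟩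
    have hsub' : (fun f => f⁻¹) '' ((fun f => Algebra.norm F (a / b) * τ f) '' I) ⊆
        {f : F | f ≠ 0} := by
      rintro _ ⟨f, hf, rfl⟩
      exact inv_ne_zero (hsub hf)
    rw [← eq_of_andreSpread_eq hcF hcK hsub' hH, Set.image_image]
    · simp only [mul_inv]
    · rw [← image_andreSpread_swap hcF hcK, ← hdiag, ← himg, Set.image_image]
      simp only [Set.image_comp]

lemma exists_many_lines (hq : 5 ≤ q) (hcF : Fintype.card F = q) (hcK : Fintype.card K = q ^ 2)
    {I H : Set F} (hIhalf : 2 * I.ncard ≤ q - 1) {ψ : K × K → K × K}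
    (himg : (fun W => ψ '' W) '' AndreSpread F K q I = AndreSpread F K q H) :
    q + 2 ≤ {k : K | IsLine (ψ '' J K k)}.ncard ∨
      q + 2 ≤ {k : K | IsLine ((conjFst q ∘ ψ) '' J K k)}.ncard := by
  have hsub : {k : K | Algebra.norm F k ∉ I} ⊆
      {k : K | IsLine (ψ '' J K k)} ∪ {k : K | IsLine ((conjFst q ∘ ψ) '' J K k)} := by
    intro k hk
    have hmem : ψ '' J K k ∈ AndreSpread F K q H := himg ▸
      Set.mem_image_of_mem _ (J_mem_andreSpread hk)
    rcases isLine_or_exists_Jq hmem with hl | ⟨k', -, -, hk'⟩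
    · exact Or.inl hl
    · refine Or.inr ?_
      change IsLine _
      rw [Set.image_comp, hk', image_conjFst_Jq hcK]
      exact isLine_J _
  have h1 := (Set.ncard_le_ncard hsub (Set.toFinite _)).trans (Set.ncard_union_le _ _)
  have h2 := ncard_norm_preimage_add_compl hcK I
  have h3 := ncard_norm_preimage_le hcF hcK I
  by_contra! h
  obtain ⟨n, rfl⟩ := Nat.exists_eq_add_of_le' hq
  have h4 : 2 * I.ncard ≤ n + 4 := by omega
  nlinarith

lemma spreadEquiv_mul (hcF : Fintype.card F = q) (hcK : Fintype.card K = q ^ 2) (I : Set F)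
    {α : F} (hα : α ≠ 0) (τ : F ≃+* F) : SpreadEquiv F K q I ((fun f => α * τ f) '' I) := by
  obtain ⟨s, hs⟩ := exists_ringEquiv_extending (K := K) τ
  obtain ⟨a, rfl⟩ := FiniteField.norm_surjective F K α
  have ha : a ≠ 0 := Algebra.norm_ne_zero_iff.mp hα
  refine ⟨τ, diagMap a 1 s, diagMap_bijective ha one_ne_zero s, ?_, ?_, ?_⟩
  · intro u v
    simp [diagMap, mul_add]
  · intro f v
    simp [diagMap, Algebra.smul_def, hs, mul_left_comm]
  · simpa using image_andreSpread_diagMap hcF hcK hs ha one_ne_zero I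

lemma spreadEquiv_inv (hcF : Fintype.card F = q) (hcK : Fintype.card K = q ^ 2) (I : Set F) :
    SpreadEquiv F K q I ((fun f => f⁻¹) '' I) :=
  ⟨RingEquiv.refl F, Prod.swap, Prod.swap_bijective, fun _ _ => rfl, fun _ _ => rfl,
    image_andreSpread_swap hcF hcK I⟩

lemma spreadEquiv_compl (hcF : Fintype.card F = q) (hcK : Fintype.card K = q ^ 2) (I : Set F) :
    SpreadEquiv F K q I ({f : F | f ≠ 0} \ I) :=
  ⟨RingEquiv.refl F, conjFst q, (conjFst_involutive hcK).bijective, conjFst_add hcF,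
    conjFst_smul hcF, image_andreSpread_conjFst hcF hcK I⟩

lemma spreadEquiv_mul_inv (hcF : Fintype.card F = q) (hcK : Fintype.card K = q ^ 2) (I : Set F)
    {α : F} (hα : α ≠ 0) (τ : F ≃+* F) : SpreadEquiv F K q I ((fun f => α * (τ f)⁻¹) '' I) := by
  have h := (spreadEquiv_mul (K := K) hcF hcK I (inv_ne_zero hα) τ).trans
    (spreadEquiv_inv hcF hcK _)
  simpa [Set.image_image, mul_comm] using h

end SpreadIsomorphisms

theorem stmt_5
    (q : ℕ) (hq : 5 ≤ q) (hqp : IsPrimePow q)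
    (F K : Type) [Field F] [Field K] [Algebra F K] [Fintype F] [Fintype K]
    (hcF : Fintype.card F = q) (hcK : Fintype.card K = q ^ 2)
    (I H : Set F) (hIss : I ⊆ {f : F | f ≠ 0}) (hHss : H ⊆ {f : F | f ≠ 0})
    (hI2 : 2 ≤ I.ncard) (hIhalf : 2 * I.ncard ≤ q - 1)
    (hH2 : 2 ≤ H.ncard) (hHhalf : 2 * H.ncard ≤ q - 1) :
    (∃ (τ : F ≃+* F) (ψ : K × K → K × K),
        Function.Bijective ψ ∧
        (∀ u v : K × K, ψ (u + v) = ψ u + ψ v) ∧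
        (∀ (f : F) (v : K × K), ψ (f • v) = τ f • ψ v) ∧
        (fun W => ψ '' W) '' AndreSpread F K q I = AndreSpread F K q H)
    ↔ ∃ (α : F) (τ' : F ≃+* F), α ≠ 0 ∧
        ((fun f => α * τ' f) '' I = H ∨
         (fun f => α * (τ' f)⁻¹) '' I = H ∨
         (2 * I.ncard = q - 1 ∧ 2 * H.ncard = q - 1 ∧
            (fun f => α * τ' f) '' I = {f : F | f ≠ 0} \ H) ∨
         (2 * I.ncard = q - 1 ∧ 2 * H.ncard = q - 1 ∧
            (fun f => α * (τ' f)⁻¹) '' I = {f : F | f ≠ 0} \ H)) := by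
  change SpreadEquiv F K q I H ↔ _
  constructor
  · rintro ⟨τ, ψ, hbij, hadd, hτ, himg⟩
    rcases exists_many_lines hq hcF hcK hIhalf himg with hT | hT
    · obtain ⟨s, hs⟩ := semilinear_of_many_lines hcF hcK hbij.1 hadd hτ (fun k hk => hk) hT
      obtain ⟨α, hα, h | h⟩ :=
        exists_image_eq_of_semilinear hcF hcK hIss hHss hI2 hbij hadd hτ hs himg
      · exact ⟨α, τ, hα, Or.inl h⟩
      · exact ⟨α, τ, hα, Or.inr (Or.inl h)⟩
    · have hbij' : Function.Bijective (conjFst q ∘ ψ) :=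
        (conjFst_involutive hcK).bijective.comp hbij
      have hadd' : ∀ u v, (conjFst q ∘ ψ) (u + v) = (conjFst q ∘ ψ) u + (conjFst q ∘ ψ) v :=
        fun u v => by simp only [Function.comp_apply, hadd, conjFst_add hcF]
      have hτ' : ∀ (f : F) v, (conjFst q ∘ ψ) (f • v) = τ f • (conjFst q ∘ ψ) v :=
        fun f v => by simp only [Function.comp_apply, hτ, conjFst_smul hcF]
      have himg' : (fun W => (conjFst q ∘ ψ) '' W) '' AndreSpread F K q I =
          AndreSpread F K q ({f : F | f ≠ 0} \ H) := by
        rw [← image_andreSpread_conjFst hcF hcK, ← himg, Set.image_image]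
        simp only [Set.image_comp]
      obtain ⟨s, hs⟩ := semilinear_of_many_lines hcF hcK hbij'.1 hadd' hτ' (fun k hk => hk) hT
      obtain ⟨α, hα, h | h⟩ := exists_image_eq_of_semilinear hcF hcK hIss Set.sdiff_subset hI2
        hbij' hadd' hτ' hs himg'
      · obtain ⟨h1, h2⟩ := ncard_eq_half hcF hHss hIhalf hHhalf
          (fun f f' hf => τ.injective (mul_left_cancel₀ hα hf)) h
        exact ⟨α, τ, hα, Or.inr (Or.inr (Or.inl ⟨h1, h2, h⟩))⟩
      · obtain ⟨h1, h2⟩ := ncard_eq_half hcF hHss hIhalf hHhalf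
          (fun f f' hf => τ.injective (inv_injective (mul_left_cancel₀ hα hf))) h
        exact ⟨α, τ, hα, Or.inr (Or.inr (Or.inr ⟨h1, h2, h⟩))⟩
  · rintro ⟨α, τ, hα, h | h | ⟨-, -, h⟩ | ⟨-, -, h⟩⟩
    · exact h ▸ spreadEquiv_mul hcF hcK I hα τ
    · exact h ▸ spreadEquiv_mul_inv hcF hcK I hα τ
    · have h1 := (h ▸ spreadEquiv_mul (K := K) hcF hcK I hα τ).trans (spreadEquiv_compl hcF hcK _)
      rwa [Set.sdiff_sdiff_cancel_left hHss] at h1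
    · have h1 := (h ▸ spreadEquiv_mul_inv (K := K) hcF hcK I hα τ).trans
        (spreadEquiv_compl hcF hcK _)
      rwa [Set.sdiff_sdiff_cancel_left hHss] at h1
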